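/- Let k ≥ 1, n ≥ 1, and consider the kn points 1, 2, …, kn on the real line, partitioned into n pairwise disjoint k-element sets S_1, …, S_n. Then there exists a coloring c : {1,…,kn} → {1,…,k} whose restriction to each S_j is a bijection onto {1,…,k}, such that whenever i < j have the same color and no index strictly between i and j has that color, at most 2k − 2 indices lie strictly between i and j (equivalently, j − i ≤ 2k − 1). -/

import Mathlib

/-- A `(d + 1)`-regular bipartite multigraph with edge set `X`, whose edge `x` joins `f x` to
`g x`, has a perfect matching. -/
theorem exists_perfect_matching_of_regular {E V : Type*} [Fintype V] [DecidableEq V]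
    (f g : E → V) (d : ℕ) (X : Finset E)
    (hf : ∀ v, (X.filter (fun x => f x = v)).card = d + 1)
    (hg : ∀ v, (X.filter (fun x => g x = v)).card = d + 1) :
    ∃ m : V → E, (∀ v, m v ∈ X) ∧ (∀ v, f (m v) = v) ∧ Function.Bijective (fun v => g (m v)) := by
  have card_preimage : ∀ h : E → V, (∀ v, (X.filter (fun x => h x = v)).card = d + 1) →
      ∀ s : Finset V, (X.filter (fun x => h x ∈ s)).card = s.card * (d + 1) := by
    intro h hh s
    rw [Finset.card_eq_sum_card_fiberwise (s := X.filter (fun x => h x ∈ s)) (f := h) (t := s)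
      (fun x hx => (Finset.mem_filter.1 (Finset.mem_coe.1 hx)).2), Finset.sum_const_nat]
    intro v hv
    rw [← hh v, Finset.filter_filter]
    congr 1
    ext x
    simp only [Finset.mem_filter]
    grind
  obtain ⟨p, hp_inj, hp⟩ := (Finset.all_card_le_biUnion_card_iff_exists_injective
    (fun v => (X.filter (fun x => f x = v)).image g)).1 (by
      intro s
      refine Nat.le_of_mul_le_mul_right ?_ d.succ_pos
      rw [← card_preimage f hf, ← card_preimage g hg]
      refine Finset.card_le_card fun x hx => ?_
      simp only [Finset.mem_filter, Finset.mem_biUnion, Finset.mem_image] at hx ⊢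
      exact ⟨hx.1, f x, hx.2, x, ⟨hx.1, rfl⟩, rfl⟩)
  simp only [Finset.mem_image, Finset.mem_filter] at hp
  choose m hm hgm using hp
  refine ⟨m, fun v => (hm v).1, fun v => (hm v).2, Finite.injective_iff_bijective.1 ?_⟩
  simpa only [hgm] using hp_inj

/-- **König's edge coloring theorem** for regular bipartite multigraphs: the edges of a
`d`-regular bipartite multigraph can be colored with `d` colors so that every color occurs
exactly once at every vertex. -/
theorem exists_edge_coloring_of_regular {E V : Type*} [Fintype V] [DecidableEq V]
    (f g : E → V) (d : ℕ) (X : Finset E)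
    (hf : ∀ v, (X.filter (fun x => f x = v)).card = d)
    (hg : ∀ v, (X.filter (fun x => g x = v)).card = d) :
    ∃ c : E → ℕ, (∀ x ∈ X, c x < d) ∧
      (∀ v, ∀ a < d, ∃! x, x ∈ X ∧ f x = v ∧ c x = a) ∧
      (∀ v, ∀ a < d, ∃! x, x ∈ X ∧ g x = v ∧ c x = a) := by
  classical
  induction d generalizing X with
  | zero =>
    refine ⟨fun _ => 0, fun x hx => ?_, by simp, by simp⟩
    exact absurd rfl (Finset.filter_eq_empty_iff.1 (Finset.card_eq_zero.1 (hf (f x))) hx)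
  | succ d ih =>
    obtain ⟨m, hmX, hfm, hgm⟩ := exists_perfect_matching_of_regular f g d X hf hg
    set M := Finset.univ.image m with hM
    have mem_M : ∀ x, x ∈ M ↔ ∃ v, m v = x := by simp [hM]
    have unique_f : ∀ v, ∃! x, x ∈ M ∧ f x = v := fun v =>
      ⟨m v, ⟨(mem_M _).2 ⟨v, rfl⟩, hfm v⟩, by
        rintro x ⟨hx, rfl⟩
        obtain ⟨w, rfl⟩ := (mem_M x).1 hx
        rw [hfm]⟩
    have unique_g : ∀ v, ∃! x, x ∈ M ∧ g x = v := fun v => by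
      obtain ⟨w, hw⟩ := hgm.2 v
      refine ⟨m w, ⟨(mem_M _).2 ⟨w, rfl⟩, hw⟩, ?_⟩
      rintro x ⟨hx, hxv⟩
      obtain ⟨u, rfl⟩ := (mem_M x).1 hx
      exact congrArg m (hgm.1 (hxv.trans hw.symm))
    have M_sub : ∀ x ∈ M, x ∈ X := fun x hx => by
      obtain ⟨v, rfl⟩ := (mem_M x).1 hx
      exact hmX v
    have card_sdiff : ∀ h : E → V, (∀ v, (X.filter (fun x => h x = v)).card = d + 1) →
        (∀ v, ∃! x, x ∈ M ∧ h x = v) →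
        ∀ v, ((X \ M).filter (fun x => h x = v)).card = d := by
      intro h hh hu v
      obtain ⟨y, ⟨hyM, hyv⟩, hy⟩ := hu v
      have : (X \ M).filter (fun x => h x = v) = (X.filter (fun x => h x = v)).erase y := by
        ext x
        simp only [Finset.mem_filter, Finset.mem_sdiff, Finset.mem_erase]
        grind
      rw [this, Finset.card_erase_of_mem (Finset.mem_filter.2 ⟨M_sub y hyM, hyv⟩), hh v,
        Nat.add_sub_cancel]
    obtain ⟨c, hc, hcf, hcg⟩ :=
      ih (X \ M) (card_sdiff f hf unique_f) (card_sdiff g hg unique_g)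
    have extend : ∀ h : E → V, (∀ v, ∃! x, x ∈ M ∧ h x = v) →
        (∀ v, ∀ a < d, ∃! x, x ∈ X \ M ∧ h x = v ∧ c x = a) →
        ∀ v, ∀ a < d + 1, ∃! x, x ∈ X ∧ h x = v ∧ (if x ∈ M then d else c x) = a := by
      intro h hu hch v a ha
      simp only [Finset.mem_sdiff] at hc hch
      rcases Nat.lt_succ_iff_lt_or_eq.1 ha with ha | rfl
      · obtain ⟨y, hy, hy'⟩ := hch v a ha
        exact ⟨y, by grind, by grind⟩
      · obtain ⟨y, hy, hy'⟩ := hu v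
        refine ⟨y, by grind, fun x hx => ?_⟩
        by_cases hxM : x ∈ M
        · exact hy' x ⟨hxM, hx.2.1⟩
        · have := hc x ⟨hx.1, hxM⟩
          grind
    refine ⟨fun x => if x ∈ M then d else c x, fun x hx => ?_,
      extend f unique_f hcf, extend g unique_g hcg⟩
    have := hc x
    grind

theorem card_filter_div_eq (k n : ℕ) (hk : 0 < k) (b : Fin n) :
    ((Finset.univ : Finset (Fin (k * n))).filter (fun x : Fin (k * n) => (x : ℕ) / k = b)).card = k := by
  have lt (r : Fin k) : k * (b : ℕ) + r < k * n :=
    calc k * (b : ℕ) + r < k * (b + 1) := by rw [mul_add, mul_one]; omega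
      _ ≤ k * n := Nat.mul_le_mul_left k b.2
  have : (Finset.univ : Finset (Fin (k * n))).filter
        (fun x : Fin (k * n) => (x : ℕ) / k = b) =
      Finset.univ.image (fun r : Fin k => (⟨k * b + r, lt r⟩ : Fin (k * n))) := by
    ext x
    simp only [Finset.mem_filter, Finset.mem_univ, true_and, Finset.mem_image]
    constructor
    · intro hx
      refine ⟨⟨x % k, Nat.mod_lt _ hk⟩, Fin.ext ?_⟩
      simpa [← hx] using Nat.div_add_mod (x : ℕ) k
    · rintro ⟨r, rfl⟩
      simp [Nat.mul_add_div hk, Nat.div_eq_of_lt r.2]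
  rw [this, Finset.card_image_of_injective, Finset.card_univ, Fintype.card_fin]
  intro r s hrs
  simpa [Fin.ext_iff] using hrs

/-- For `k ≥ 1`, `n ≥ 1`, the `kn` unit-spaced points `1, …, kn`
on the line (indexed by `Fin (k*n)`), partitioned into `n` pairwise disjoint
`k`-element sets `S 1, …, S n`, admit a coloring with `k` colors that is a
bijection on each `S j` and such that any two consecutive same-colored points
have at most `2k - 2` points strictly between them (i.e. their index
difference is at most `2k - 1`). -/
theorem k_coloring_on_line (k n : ℕ) (hk : 1 ≤ k) (hn : 1 ≤ n)
    (S : Fin n → Finset (Fin (k * n)))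
    (hdisj : ∀ i j : Fin n, i ≠ j → Disjoint (S i) (S j))
    (hcard : ∀ j : Fin n, (S j).card = k)
    (hcover : ∀ x : Fin (k * n), ∃ j : Fin n, x ∈ S j) :
    ∃ c : Fin (k * n) → Fin k,
      (∀ j : Fin n, ∀ a : Fin k, ∃! x, x ∈ S j ∧ c x = a) ∧
      ∀ i j : Fin (k * n), i < j → c i = c j →
        (∀ m : Fin (k * n), i < m → m < j → c m ≠ c i) →
        (j : ℕ) - (i : ℕ) ≤ 2 * k - 1 := by
  choose f hf using hcover
  have mem_iff : ∀ x j, x ∈ S j ↔ f x = j := fun x j =>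
    ⟨fun hx => by_contra fun hne => Finset.disjoint_left.1 (hdisj _ _ hne) (hf x) hx,
      fun hx => hx ▸ hf x⟩
  let block : Fin (k * n) → Fin n := fun x => ⟨x / k, Nat.div_lt_of_lt_mul x.2⟩
  obtain ⟨c, hc, hcf, hcg⟩ := exists_edge_coloring_of_regular f block k Finset.univ
    (fun j => by
      refine (congrArg Finset.card ?_).trans (hcard j)
      ext x
      simp [mem_iff])
    (fun b => by simpa only [block, Fin.ext_iff] using card_filter_div_eq k n hk b)
  simp only [Finset.mem_univ, true_and, forall_true_left] at hc hcf hcg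
  refine ⟨fun x => ⟨c x, hc x⟩, fun j a => ?_, fun i j hij hcij hbetween => ?_⟩
  · simpa only [mem_iff, Fin.ext_iff] using hcf j a a.2
  · simp only [Fin.ext_iff, ne_eq] at hcij hbetween
    have hi := Nat.div_add_mod (i : ℕ) k
    have hj := Nat.div_add_mod (j : ℕ) k
    have hjk := Nat.mod_lt (j : ℕ) hk
    have hsucc : (j : ℕ) / k ≤ i / k + 1 := by
      by_contra! hlt
      obtain ⟨x, ⟨hxb, hxc⟩, -⟩ :=
        hcg ⟨i / k + 1, hlt.trans (block j).2⟩ (c i) (hc i)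
      have hx : (x : ℕ) / k = i / k + 1 := congrArg Fin.val hxb
      refine hbetween x ?_ ?_ hxc
      · exact Fin.lt_def.2 (Nat.lt_of_div_lt_div (c := k) (by omega))
      · exact Fin.lt_def.2 (Nat.lt_of_div_lt_div (c := k) (by omega))
    have hmul := Nat.mul_le_mul_left k hsucc
    rw [mul_add, mul_one] at hmul
    omega
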